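/- For every nontrivial δ in Δ = ⟨a,b,c,d | a³,b²,c²,d³,abcd⟩ there exists N such that for every n > N, ψₙ(δ) ≠ 1, where ψₙ : Δ → ℤ/3 * ℤ/2 is defined by a ↦ x, b ↦ y, c ↦ (xy)ⁿ y (xy)⁻ⁿ, d ↦ (xy)ⁿ x⁻¹ (xy)⁻ⁿ. In particular Δ is residually (ℤ/3 * ℤ/2). -/

import Mathlib

/-- The relations of `Δ = ⟨a,b,c,d | a³, b², c², d³, abcd⟩`
(generators `a,b,c,d` indexed by `0,1,2,3 : Fin 4`). -/
def deltaRels : Set (FreeGroup (Fin 4)) :=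
  {FreeGroup.of 0 ^ 3, FreeGroup.of 1 ^ 2, FreeGroup.of 2 ^ 2, FreeGroup.of 3 ^ 3,
    FreeGroup.of 0 * FreeGroup.of 1 * FreeGroup.of 2 * FreeGroup.of 3}

/-- The relations of `Ξ = ⟨x, y | x³, y²⟩ ≅ ℤ/3 * ℤ/2`. -/
def xiRels : Set (FreeGroup (Fin 2)) :=
  {FreeGroup.of 0 ^ 3, FreeGroup.of 1 ^ 2}

namespace DeltaDouble

open scoped Matrix MatrixGroups
open ModularGroup

/-- The group `Ξ = ⟨x, y | x³, y²⟩`. -/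
abbrev Xi : Type := PresentedGroup xiRels

/-- The group `Δ = ⟨a, b, c, d | a³, b², c², d³, abcd⟩`. -/
abbrev Delta : Type := PresentedGroup deltaRels

/-- The generator `x` of `Ξ`. -/
def x : Xi := PresentedGroup.of 0

/-- The generator `y` of `Ξ`. -/
def y : Xi := PresentedGroup.of 1

/-- The element `t = xy` of `Ξ`. -/
def t : Xi := x * y

theorem x_pow_three : x ^ 3 = 1 :=
  PresentedGroup.one_of_mem (rels := xiRels) (x := FreeGroup.of 0 ^ 3) (by simp [xiRels])

theorem y_sq : y ^ 2 = 1 :=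
  PresentedGroup.one_of_mem (rels := xiRels) (x := FreeGroup.of 1 ^ 2) (by simp [xiRels])

theorem y_mul_y : y * y = 1 := by rw [← sq, y_sq]

theorem y_inv : y⁻¹ = y := inv_eq_of_mul_eq_one_left y_mul_y

theorem x_mul_x : x * x = x⁻¹ := by
  rw [eq_inv_iff_mul_eq_one, ← pow_three', x_pow_three]

theorem xi_induction {p : Xi → Prop} (one : p 1) (x_mul : ∀ g, p g → p (x * g))
    (y_mul : ∀ g, p g → p (y * g)) (g : Xi) : p g := by
  have hg : g ∈ Subgroup.closure (Set.range (PresentedGroup.of : Fin 2 → Xi)) := by simp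
  induction hg using Subgroup.closure_induction_left with
  | one => exact one
  | mul_left s hs g _ ih =>
    obtain ⟨i, rfl⟩ := hs
    fin_cases i
    · exact x_mul g ih
    · exact y_mul g ih
  | inv_mul_cancel s hs g _ ih =>
    obtain ⟨i, rfl⟩ := hs
    fin_cases i
    · change p (x⁻¹ * g)
      rw [← x_mul_x, mul_assoc]
      exact x_mul _ (x_mul _ ih)
    · change p (y⁻¹ * g)
      rw [y_inv]
      exact y_mul g ih

/-! ### The representation of `Ξ` in `PSL(2, ℤ)` -/

/-- The lower triangular elementary matrix. -/
def lowerUnipotent : SL(2, ℤ) := ⟨!![1, 0; 1, 1], by simp [Matrix.det_fin_two]⟩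

theorem coe_lowerUnipotent :
    (lowerUnipotent : Matrix (Fin 2) (Fin 2) ℤ) = !![1, 0; 1, 1] := rfl

theorem neg_one_mem_center : (-1 : SL(2, ℤ)) ∈ Subgroup.center SL(2, ℤ) :=
  Subgroup.mem_center_iff.2 fun g => by simp

/-- The homomorphism `Ξ → PSL(2, ℤ)` sending `xy` to the parabolic translation `T`. -/
def toPSL : Xi →* PSL(2, ℤ) :=
  PresentedGroup.toGroup (f := ![((T * S⁻¹ : SL(2, ℤ)) : PSL(2, ℤ)), ((S : SL(2, ℤ)) : PSL(2, ℤ))])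
    (by
      rintro r (rfl | rfl)
      · have h : (T * S⁻¹) ^ 3 = 1 := by
          ext i j
          fin_cases i <;> fin_cases j <;> decide
        simp only [map_pow, FreeGroup.lift_apply_of, Matrix.cons_val_zero]
        rw [← QuotientGroup.mk_pow, h, QuotientGroup.mk_one]
      · have h : S ^ 2 = -1 := by
          ext i j
          fin_cases i <;> fin_cases j <;> decide
        simp only [map_pow, FreeGroup.lift_apply_of, Matrix.cons_val_one, Matrix.cons_val_fin_one]
        rw [← QuotientGroup.mk_pow, h, QuotientGroup.eq_one_iff]
        exact neg_one_mem_center)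

/-- The matrix `M` is a lift of the image of `g` in `PSL(2, ℤ)`. -/
def Represents (M : SL(2, ℤ)) (g : Xi) : Prop := (M : PSL(2, ℤ)) = toPSL g

theorem represents_one : Represents 1 1 := by
  simp [Represents]

theorem Represents.mul {M M' : SL(2, ℤ)} {g g' : Xi} (h : Represents M g)
    (h' : Represents M' g') : Represents (M * M') (g * g') := by
  unfold Represents at *
  rw [QuotientGroup.mk_mul, h, h', map_mul]

theorem Represents.inv {M : SL(2, ℤ)} {g : Xi} (h : Represents M g) : Represents M⁻¹ g⁻¹ := by
  unfold Represents at *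
  rw [QuotientGroup.mk_inv, h, map_inv]

theorem Represents.zpow {M : SL(2, ℤ)} {g : Xi} (h : Represents M g) (k : ℤ) :
    Represents (M ^ k) (g ^ k) := by
  unfold Represents at *
  rw [QuotientGroup.mk_zpow, h, map_zpow]

theorem represents_x : Represents (T * S⁻¹) x := by
  rw [Represents, toPSL, x, PresentedGroup.toGroup.of]
  rfl

theorem represents_y : Represents S y := by
  rw [Represents, toPSL, y, PresentedGroup.toGroup.of]
  rfl

theorem represents_t : Represents T t := by
  have h := represents_x.mul represents_y
  rwa [inv_mul_cancel_right] at h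

theorem Represents.neg {M : SL(2, ℤ)} {g : Xi} (h : Represents M g) : Represents (-M) g := by
  unfold Represents at *
  rw [← h, eq_comm, QuotientGroup.eq]
  simpa using neg_one_mem_center

theorem represents_lowerUnipotent : Represents lowerUnipotent (x⁻¹ * y) := by
  have h := (represents_x.inv.mul represents_y).neg
  convert h using 1
  ext i j
  fin_cases i <;> fin_cases j <;> decide

theorem exists_represents (g : Xi) : ∃ M, Represents M g :=
  QuotientGroup.mk_surjective (toPSL g)

theorem Represents.lower_left_eq_zero {M M' : SL(2, ℤ)} {g : Xi} (h : Represents M g)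
    (h' : Represents M' g) (h0 : M 1 0 = 0) : M' 1 0 = 0 := by
  have hc : M⁻¹ * M' ∈ Subgroup.center SL(2, ℤ) := QuotientGroup.eq.1 (h.trans h'.symm)
  obtain ⟨r, -, hr⟩ := Matrix.SpecialLinearGroup.mem_center_iff.1 hc
  have hM : (M' : Matrix (Fin 2) (Fin 2) ℤ) = M * Matrix.scalar (Fin 2) r := by
    rw [hr, ← Matrix.SpecialLinearGroup.coe_mul, mul_inv_cancel_left]
  rw [hM, Matrix.scalar_apply, Matrix.mul_diagonal, h0, zero_mul]

/-! ### The stabilizer of infinity -/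

/-- The submonoid of `Ξ` generated by `xy` and `x⁻¹y`. -/
inductive Positive : Xi → Prop
  | one : Positive 1
  | upper (w : Xi) : Positive w → Positive (t * w)
  | lower (w : Xi) : Positive w → Positive (x⁻¹ * y * w)

theorem Positive.exists_represents {w : Xi} (hw : Positive w) :
    ∃ M, Represents M w ∧ 1 ≤ M 0 0 ∧ 1 ≤ M 1 1 ∧ 0 ≤ M 0 1 ∧ 0 ≤ M 1 0 ∧
      (M 1 0 = 0 → w ∈ Subgroup.zpowers t) ∧
      (M 0 1 = 0 → w ∈ Subgroup.zpowers (x⁻¹ * y)) := by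
  induction hw with
  | one => exact ⟨1, represents_one, by simp [one_mem]⟩
  | upper w _ ih =>
    obtain ⟨M, hM, h00, h11, h01, h10, ht, -⟩ := ih
    refine ⟨T * M, represents_t.mul hM, ?_⟩
    simp only [Matrix.SpecialLinearGroup.coe_mul, coe_T, Matrix.mul_apply, Fin.sum_univ_two,
      Matrix.of_apply, Matrix.cons_val_zero, Matrix.cons_val_one, Matrix.cons_val',
      Matrix.cons_val_fin_one]
    refine ⟨by linarith, by linarith, by linarith, by linarith, fun h => ?_, fun h => ?_⟩
    · exact mul_mem (Subgroup.mem_zpowers t) (ht (by linarith))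
    · linarith
  | lower w _ ih =>
    obtain ⟨M, hM, h00, h11, h01, h10, -, hs⟩ := ih
    refine ⟨lowerUnipotent * M, represents_lowerUnipotent.mul hM, ?_⟩
    simp only [Matrix.SpecialLinearGroup.coe_mul, coe_lowerUnipotent, Matrix.mul_apply,
      Fin.sum_univ_two, Matrix.of_apply, Matrix.cons_val_zero, Matrix.cons_val_one,
      Matrix.cons_val', Matrix.cons_val_fin_one]
    refine ⟨by linarith, by linarith, by linarith, by linarith, fun h => ?_, fun h => ?_⟩
    · linarith
    · exact mul_mem (Subgroup.mem_zpowers _) (hs (by linarith))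

theorem exists_positive_decomposition (g : Xi) :
    ∃ w r, Positive w ∧ (r = 1 ∨ r = x ∨ r = x⁻¹) ∧ (g = w * r ∨ g = y * w * r) := by
  induction g using xi_induction with
  | one => exact ⟨1, 1, .one, by simp⟩
  | x_mul g ih =>
    obtain ⟨w, r, hw, hr, rfl | rfl⟩ := ih
    · cases hw with
      | one =>
        refine ⟨1, x * r, .one, ?_, by simp⟩
        rcases hr with rfl | rfl | rfl <;> simp [x_mul_x]
      | upper w hw =>
        refine ⟨_, r, .lower w hw, hr, .inl ?_⟩
        simp only [t, ← mul_assoc, x_mul_x]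
      | lower w hw =>
        refine ⟨w, r, hw, hr, .inr ?_⟩
        simp only [← mul_assoc, mul_inv_cancel, one_mul]
    · exact ⟨_, r, .upper w hw, hr, .inl (by simp only [t, mul_assoc])⟩
  | y_mul g ih =>
    obtain ⟨w, r, hw, hr, rfl | rfl⟩ := ih
    · exact ⟨w, r, hw, hr, .inr (by simp only [mul_assoc])⟩
    · exact ⟨w, r, hw, hr, .inl (by simp only [← mul_assoc, y_mul_y, one_mul])⟩

theorem y_mul_x_inv : y * x⁻¹ = t⁻¹ := by
  rw [t, mul_inv_rev, y_inv]

theorem mem_zpowers_of_lower_left_eq_zero {M : SL(2, ℤ)} {g : Xi} (hM : Represents M g)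
    (h0 : M 1 0 = 0) : g ∈ Subgroup.zpowers t := by
  obtain ⟨w, r, hw, hr, hg⟩ := exists_positive_decomposition g
  obtain ⟨W, hW, h00, h11, h01, h10, ht, hs⟩ := hw.exists_represents
  have key : ∀ R, Represents R r → (g = w * r → (W * R) 1 0 = 0) ∧
      (g = y * w * r → (S * W * R) 1 0 = 0) := fun R hR =>
    ⟨fun h => (h ▸ hM).lower_left_eq_zero (hW.mul hR) h0,
      fun h => (h ▸ hM).lower_left_eq_zero ((represents_y.mul hW).mul hR) h0⟩
  rcases hr with rfl | rfl | rfl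
  · obtain ⟨h₁, h₂⟩ := key 1 represents_one
    simp only [Matrix.SpecialLinearGroup.coe_mul, coe_S, mul_one, Matrix.mul_apply, Fin.sum_univ_two,
      Matrix.of_apply, Matrix.cons_val_zero, Matrix.cons_val_one, Matrix.cons_val',
      Matrix.cons_val_fin_one] at h₁ h₂
    simp only [mul_one] at hg
    rcases hg with hg | hg
    · rw [hg]
      exact ht (h₁ hg)
    · linarith [h₂ hg]
  · obtain ⟨R, hR, hRe⟩ : ∃ R, Represents R x ∧ (R : Matrix (Fin 2) (Fin 2) ℤ) = !![-1, 1; -1, 0] :=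
      ⟨_, represents_x, by decide⟩
    obtain ⟨h₁, h₂⟩ := key R hR
    simp only [Matrix.SpecialLinearGroup.coe_mul, coe_S, hRe, Matrix.mul_apply, Fin.sum_univ_two,
      Matrix.of_apply, Matrix.cons_val_zero, Matrix.cons_val_one, Matrix.cons_val',
      Matrix.cons_val_fin_one] at h₁ h₂
    rcases hg with hg | hg
    · linarith [h₁ hg]
    · linarith [h₂ hg]
  · obtain ⟨R, hR, hRe⟩ :
        ∃ R, Represents R x⁻¹ ∧ (R : Matrix (Fin 2) (Fin 2) ℤ) = !![0, -1; 1, -1] :=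
      ⟨_, represents_x.inv, by decide⟩
    obtain ⟨h₁, h₂⟩ := key R hR
    simp only [Matrix.SpecialLinearGroup.coe_mul, coe_S, hRe, Matrix.mul_apply, Fin.sum_univ_two,
      Matrix.of_apply, Matrix.cons_val_zero, Matrix.cons_val_one, Matrix.cons_val',
      Matrix.cons_val_fin_one] at h₁ h₂
    rcases hg with hg | hg
    · linarith [h₁ hg]
    · obtain ⟨k, rfl⟩ := hs (by linarith [h₂ hg])
      have h : g = y * (x⁻¹ * y) ^ k * y⁻¹ * (y * x⁻¹) := by
        simp only [hg, mul_assoc, inv_mul_cancel_left]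
      rw [h, ← conj_zpow, ← mul_assoc y, mul_inv_cancel_right, y_mul_x_inv, inv_zpow]
      exact mul_mem (inv_mem (zpow_mem (Subgroup.mem_zpowers t) k))
        (inv_mem (Subgroup.mem_zpowers t))

theorem lower_left_ne_zero {M : SL(2, ℤ)} {g : Xi} (hM : Represents M g)
    (hg : g ∉ Subgroup.zpowers t) : M 1 0 ≠ 0 :=
  fun h => hg (mem_zpowers_of_lower_left_eq_zero hM h)

/-! ### `Δ` as a double of `Ξ` along `⟨t⟩` -/

theorem delta_relations :
    (PresentedGroup.of 0 : Delta) ^ 3 = 1 ∧ (PresentedGroup.of 1 : Delta) ^ 2 = 1 ∧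
      (PresentedGroup.of 2 : Delta) ^ 2 = 1 ∧ (PresentedGroup.of 3 : Delta) ^ 3 = 1 ∧
      (PresentedGroup.of 0 * PresentedGroup.of 1 * PresentedGroup.of 2 * PresentedGroup.of 3 :
        Delta) = 1 := by
  have h : ∀ r ∈ deltaRels, PresentedGroup.mk deltaRels r = 1 :=
    fun r hr => PresentedGroup.one_of_mem hr
  exact ⟨h (FreeGroup.of 0 ^ 3) (by simp [deltaRels]), h (FreeGroup.of 1 ^ 2) (by simp [deltaRels]),
    h (FreeGroup.of 2 ^ 2) (by simp [deltaRels]), h (FreeGroup.of 3 ^ 3) (by simp [deltaRels]),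
    h (FreeGroup.of 0 * FreeGroup.of 1 * FreeGroup.of 2 * FreeGroup.of 3) (by simp [deltaRels])⟩

/-- The two inclusions `Ξ → Δ`, with images `⟨a, b⟩` and `⟨c, d⟩`. -/
def incl : Bool → Xi →* Delta
  | false => PresentedGroup.toGroup (f := ![PresentedGroup.of 0, PresentedGroup.of 1]) (by
      rintro r (rfl | rfl)
      · simpa using delta_relations.1
      · simpa using delta_relations.2.1)
  | true => PresentedGroup.toGroup (f := ![(PresentedGroup.of 3)⁻¹, PresentedGroup.of 2]) (by
      rintro r (rfl | rfl)
      · simpa using delta_relations.2.2.2.1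
      · simpa using delta_relations.2.2.1)

theorem incl_false_x : incl false x = PresentedGroup.of 0 := by
  rw [incl, x, PresentedGroup.toGroup.of]
  rfl

theorem incl_false_y : incl false y = PresentedGroup.of 1 := by
  rw [incl, y, PresentedGroup.toGroup.of]
  rfl

theorem incl_true_x : incl true x = (PresentedGroup.of 3)⁻¹ := by
  rw [incl, x, PresentedGroup.toGroup.of]
  rfl

theorem incl_true_y : incl true y = PresentedGroup.of 2 := by
  rw [incl, y, PresentedGroup.toGroup.of]
  rfl

theorem incl_t (b b' : Bool) : incl b t = incl b' t := by
  have h : incl false t = incl true t := by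
    obtain ⟨-, -, hc, -, h⟩ := delta_relations
    rw [sq, ← eq_inv_iff_mul_eq_one] at hc
    rw [t, map_mul, map_mul, incl_false_x, incl_false_y, incl_true_x, incl_true_y,
      hc, ← mul_inv_rev,
      eq_inv_iff_mul_eq_one, ← mul_assoc, h]
  cases b <;> cases b' <;> simp [h]

theorem incl_eq_of_mem_zpowers {g : Xi} (hg : g ∈ Subgroup.zpowers t) (b b' : Bool) :
    incl b g = incl b' g := by
  obtain ⟨k, rfl⟩ := hg
  simp only [map_zpow, incl_t b b']

/-- Nonempty alternating products of elements of the two copies of `Ξ` that lie outside `⟨t⟩`;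
the index is the copy containing the first factor. -/
inductive Reduced : Bool → Delta → Prop
  | single (b : Bool) (g : Xi) : g ∉ Subgroup.zpowers t → Reduced b (incl b g)
  | cons (b : Bool) (g : Xi) (δ : Delta) :
      g ∉ Subgroup.zpowers t → Reduced (!b) δ → Reduced b (incl b g * δ)

theorem Reduced.zpowers_mul {b : Bool} {δ : Delta} (h : Reduced b δ) {g : Xi}
    (hg : g ∈ Subgroup.zpowers t) (b' : Bool) : Reduced b (incl b' g * δ) := by
  rw [incl_eq_of_mem_zpowers hg b' b]
  cases h with
  | single _ g' hg' =>
    rw [← map_mul]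
    exact .single _ _ (by rwa [Subgroup.mul_mem_cancel_left _ hg])
  | cons _ g' δ hg' hδ =>
    rw [← mul_assoc, ← map_mul]
    exact .cons _ _ _ (by rwa [Subgroup.mul_mem_cancel_left _ hg]) hδ

/-- An element of `Δ` is in normal form if it is in `⟨t⟩` or is a reduced product. -/
def IsNormalForm (δ : Delta) : Prop :=
  (∃ g ∈ Subgroup.zpowers t, δ = incl false g) ∨ ∃ b, Reduced b δ

theorem isNormalForm_incl (b : Bool) (g : Xi) : IsNormalForm (incl b g) := by
  by_cases hg : g ∈ Subgroup.zpowers t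
  · exact .inl ⟨g, hg, incl_eq_of_mem_zpowers hg _ _⟩
  · exact .inr ⟨b, .single b g hg⟩

theorem Reduced.isNormalForm_incl_mul {b : Bool} {δ : Delta} (h : Reduced (!b) δ) (g : Xi) :
    IsNormalForm (incl b g * δ) := by
  by_cases hg : g ∈ Subgroup.zpowers t
  · exact .inr ⟨_, h.zpowers_mul hg b⟩
  · exact .inr ⟨b, .cons b g δ hg h⟩

theorem IsNormalForm.incl_mul {δ : Delta} (h : IsNormalForm δ) (b : Bool) (g : Xi) :
    IsNormalForm (incl b g * δ) := by
  obtain ⟨g', hg', rfl⟩ | ⟨b', h⟩ := h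
  · rw [incl_eq_of_mem_zpowers hg' false b, ← map_mul]
    exact isNormalForm_incl b _
  · obtain rfl | rfl := Bool.eq_or_eq_not b' b
    · cases h with
      | single _ g' _ =>
        rw [← map_mul]
        exact isNormalForm_incl _ _
      | cons _ g' δ _ hδ =>
        rw [← mul_assoc, ← map_mul]
        exact hδ.isNormalForm_incl_mul _
    · exact h.isNormalForm_incl_mul g

theorem exists_incl_eq_of (i : Fin 4) : ∃ b g, (PresentedGroup.of i : Delta) = incl b g := by
  fin_cases i
  · exact ⟨false, x, incl_false_x.symm⟩
  · exact ⟨false, y, incl_false_y.symm⟩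
  · exact ⟨true, y, incl_true_y.symm⟩
  · exact ⟨true, x⁻¹, by rw [map_inv, incl_true_x, inv_inv]; rfl⟩

theorem isNormalForm (δ : Delta) : IsNormalForm δ := by
  have hδ : δ ∈ Subgroup.closure (Set.range (PresentedGroup.of : Fin 4 → Delta)) := by simp
  induction hδ using Subgroup.closure_induction_left with
  | one => simpa using isNormalForm_incl false 1
  | mul_left s hs δ _ ih =>
    obtain ⟨i, rfl⟩ := hs
    obtain ⟨b, g, h⟩ := exists_incl_eq_of i
    rw [h]
    exact ih.incl_mul b g
  | inv_mul_cancel s hs δ _ ih =>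
    obtain ⟨i, rfl⟩ := hs
    obtain ⟨b, g, h⟩ := exists_incl_eq_of i
    rw [h, ← map_inv]
    exact ih.incl_mul b g⁻¹

/-! ### Growth of the images of reduced products -/

/-- The homomorphism `ψ` retracts `Δ` onto the first copy of `Ξ`, and is conjugation by `tⁿ` on
the second one. -/
structure IsTwistedFold (n : ℕ) (ψ : Delta →* Xi) : Prop where
  first (g : Xi) : ψ (incl false g) = g
  second (g : Xi) : ψ (incl true g) = t ^ n * g * (t ^ n)⁻¹

theorem isTwistedFold {n : ℕ} {ψ : Delta →* Xi} (h0 : ψ (PresentedGroup.of 0) = x)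
    (h1 : ψ (PresentedGroup.of 1) = y)
    (h2 : ψ (PresentedGroup.of 2) = t ^ n * y * (t ^ n)⁻¹)
    (h3 : ψ (PresentedGroup.of 3) = t ^ n * x⁻¹ * (t ^ n)⁻¹) : IsTwistedFold n ψ where
  first g := by
    induction g using xi_induction with
    | one => simp
    | x_mul g ih => rw [map_mul, map_mul, ih, incl_false_x, h0]
    | y_mul g ih => rw [map_mul, map_mul, ih, incl_false_y, h1]
  second g := by
    induction g using xi_induction with
    | one => simp
    | x_mul g ih => rw [map_mul, map_mul, ih, incl_true_x, map_inv, h3]; group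
    | y_mul g ih => rw [map_mul, map_mul, ih, incl_true_y, h2]; group

/-- The exponent of the power of `t` by which `ψₙ` conjugates the given copy of `Ξ`. -/
def twist (n : ℕ) (b : Bool) : ℤ := bif b then n else 0

theorem IsTwistedFold.map_incl {n : ℕ} {ψ : Delta →* Xi} (h : IsTwistedFold n ψ) (b : Bool)
    (g : Xi) : ψ (incl b g) = t ^ twist n b * g * t ^ (-twist n b) := by
  cases b
  · simp [twist, h.first]
  · simp [twist, h.second]

theorem exists_bound_mul (A : SL(2, ℤ)) (hA : A 1 0 ≠ 0) (C : ℤ) :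
    ∃ C' N : ℤ, ∀ (m : ℤ) (M : SL(2, ℤ)), N ≤ |m| → M 1 0 ≠ 0 → |M 0 0| ≤ C * |M 1 0| →
      (A * (T ^ m * M)) 1 0 ≠ 0 ∧ |(A * (T ^ m * M)) 0 0| ≤ C' * |(A * (T ^ m * M)) 1 0| := by
  refine ⟨2 * (|A 0 0| + |A 0 1|), C + 2 * |A 1 1| + 1, fun m M hm hM hC => ?_⟩
  have e : ∀ i, (A * (T ^ m * M)) i 0 = A i 0 * (M 0 0 + m * M 1 0) + A i 1 * M 1 0 := by
    intro i
    simp only [Matrix.SpecialLinearGroup.coe_mul, coe_T_zpow, Matrix.mul_apply, Fin.sum_univ_two,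
      Matrix.of_apply, Matrix.cons_val_zero, Matrix.cons_val_one, Matrix.cons_val',
      Matrix.cons_val_fin_one]
    ring
  rw [e 0, e 1]
  generalize A 0 0 = a, A 0 1 = b, A 1 0 = c, A 1 1 = d, M 0 0 = u, M 1 0 = v at *
  have hv : 0 < |v| := abs_pos.2 hM
  have hc : 1 ≤ |c| := Int.one_le_abs hA
  have hw : (2 * |d| + 1) * |v| ≤ |u + m * v| := by
    have h1 : |m * v| ≤ |u + m * v| + |u| := by
      simpa using abs_sub (u + m * v) u
    rw [abs_mul] at h1
    nlinarith
  generalize u + m * v = w at *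
  have h1 : |c| * |w| ≤ |c * w + d * v| + |d| * |v| := by
    rw [← abs_mul, ← abs_mul]
    simpa using abs_sub (c * w + d * v) (d * v)
  have hd := abs_nonneg d
  have hcw : |w| ≤ |c| * |w| := le_mul_of_one_le_left (abs_nonneg w) hc
  have h2 : |w| ≤ 2 * |c * w + d * v| := by linarith
  have h3 : |a * w + b * v| ≤ |a| * |w| + |b| * |v| := by
    rw [← abs_mul, ← abs_mul]
    exact abs_add_le _ _
  have hvw : |v| ≤ |w| := by nlinarith
  refine ⟨fun h => ?_, ?_⟩
  · rw [h, abs_zero] at h2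
    linarith
  · have ha := abs_nonneg a
    have hb := abs_nonneg b
    nlinarith

theorem Reduced.exists_bound {b : Bool} {δ : Delta} (h : Reduced b δ) :
    ∃ C N : ℤ, ∀ (n : ℕ) (ψ : Delta →* Xi), N ≤ n → IsTwistedFold n ψ →
      ∃ M, Represents M (t ^ (-twist n b) * ψ δ) ∧ M 1 0 ≠ 0 ∧ |M 0 0| ≤ C * |M 1 0| := by
  induction h with
  | single b g hg =>
    obtain ⟨A, hA⟩ := exists_represents g
    have hA0 := lower_left_ne_zero hA hg
    refine ⟨|A 0 0|, 0, fun n ψ _ hψ => ⟨A * T ^ (-twist n b), ?_, ?_⟩⟩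
    · rw [hψ.map_incl, mul_assoc, ← mul_assoc, ← zpow_add, neg_add_cancel, zpow_zero, one_mul]
      exact hA.mul (represents_t.zpow _)
    · have e : ∀ i, (A * T ^ (-twist n b)) i 0 = A i 0 := by
        intro i
        simp [Matrix.mul_apply, coe_T_zpow]
      rw [e, e]
      exact ⟨hA0, le_mul_of_one_le_right (abs_nonneg _) (Int.one_le_abs hA0)⟩
  | cons b g δ hg _ ih =>
    obtain ⟨A, hA⟩ := exists_represents g
    obtain ⟨C, N, ih⟩ := ih
    obtain ⟨C', N', hC'⟩ := exists_bound_mul A (lower_left_ne_zero hA hg) C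
    refine ⟨C', max N N', fun n ψ hn hψ => ?_⟩
    obtain ⟨M, hM, hM0, hMC⟩ := ih n ψ (le_of_max_le_left hn) hψ
    refine ⟨A * (T ^ (twist n (!b) - twist n b) * M), ?_, hC' _ M ?_ hM0 hMC⟩
    · convert hA.mul ((represents_t.zpow (twist n (!b) - twist n b)).mul hM) using 1
      rw [map_mul, hψ.map_incl]
      group
    · cases b <;> simpa [twist] using le_of_max_le_right hn

theorem Reduced.exists_forall_ne_one {b : Bool} {δ : Delta} (h : Reduced b δ) :
    ∃ N : ℤ, ∀ (n : ℕ) (ψ : Delta →* Xi), N ≤ n → IsTwistedFold n ψ → ψ δ ≠ 1 := by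
  obtain ⟨C, N, hN⟩ := h.exists_bound
  refine ⟨N, fun n ψ hn hψ h1 => ?_⟩
  obtain ⟨M, hM, hM0, -⟩ := hN n ψ hn hψ
  rw [h1, mul_one] at hM
  exact hM0 ((represents_t.zpow _).lower_left_eq_zero hM (by simp [coe_T_zpow]))

end DeltaDouble

/-- For every nontrivial `δ ∈ Δ` there is `N` such that for all `n > N`,
`ψₙ(δ) ≠ 1`, where `ψₙ : Δ → Ξ = ℤ/3 * ℤ/2` is the homomorphism with `a ↦ x`,
`b ↦ y`, `c ↦ (xy)ⁿ y (xy)⁻ⁿ`, `d ↦ (xy)ⁿ x⁻¹ (xy)⁻ⁿ`.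
In particular `Δ` is residually `ℤ/3 * ℤ/2`. -/
theorem psi_n_eventually_nontrivial (δ : PresentedGroup deltaRels) (hδ : δ ≠ 1) :
    ∃ N : ℕ, ∀ n : ℕ, N < n →
      ∀ ψ : PresentedGroup deltaRels →* PresentedGroup xiRels,
        ψ (PresentedGroup.of 0) = PresentedGroup.of 0 →
        ψ (PresentedGroup.of 1) = PresentedGroup.of 1 →
        ψ (PresentedGroup.of 2) =
          (PresentedGroup.of 0 * PresentedGroup.of 1) ^ n * PresentedGroup.of 1 *
            ((PresentedGroup.of 0 * PresentedGroup.of 1) ^ n)⁻¹ →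
        ψ (PresentedGroup.of 3) =
          (PresentedGroup.of 0 * PresentedGroup.of 1) ^ n * (PresentedGroup.of 0)⁻¹ *
            ((PresentedGroup.of 0 * PresentedGroup.of 1) ^ n)⁻¹ →
        ψ δ ≠ 1 := by
  obtain ⟨g, -, rfl⟩ | ⟨b, h⟩ := DeltaDouble.isNormalForm δ
  · refine ⟨0, fun n _ ψ h0 h1 h2 h3 h => hδ ?_⟩
    rw [(DeltaDouble.isTwistedFold h0 h1 h2 h3).first] at h
    rw [h, map_one]
  · obtain ⟨N, hN⟩ := h.exists_forall_ne_one
    exact ⟨N.toNat, fun n hn ψ h0 h1 h2 h3 =>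
      hN n ψ (Int.toNat_le.1 hn.le) (DeltaDouble.isTwistedFold h0 h1 h2 h3)⟩
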